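/- The system E_c^{∇•} is sound and strongly complete with respect to the class of (c)-frames: for every set Γ ∪ {φ} of L(∇,•)-formulas, Γ ⊢_{E_c^{∇•}} φ if and only if every pointed model (M,s) with M a (c)-model satisfying all members of Γ also satisfies φ. -/

import Mathlib

/-- The language L(∇,•) over propositional variables indexed by ℕ. -/
inductive Formula : Type
  | atom : ℕ → Formula
  | neg : Formula → Formula
  | and : Formula → Formula → Formula
  | nabla : Formula → Formula
  | bullet : Formula → Formula

namespace Formula

/-- Disjunction, defined from ¬ and ∧ as usual. -/
def or (φ ψ : Formula) : Formula := neg ((neg φ).and (neg ψ))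

/-- Implication, defined from ¬ and ∧ as usual. -/
def imp (φ ψ : Formula) : Formula := (neg φ).or ψ

/-- Biimplication, defined from ¬ and ∧ as usual. -/
def biimp (φ ψ : Formula) : Formula := (φ.imp ψ).and (ψ.imp φ)

/-- A fixed tautology ⊤. -/
def top : Formula := (atom 0).imp (atom 0)

/-- Δφ := ¬∇φ. -/
def delta (φ : Formula) : Formula := neg (nabla φ)

/-- ∘φ := ¬•φ. -/
def circ (φ : Formula) : Formula := neg (bullet φ)

end Formula

/-- A neighborhood model. -/
structure NbhdModel : Type 1 where
  S : Type
  ne : Nonempty S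
  N : S → Set (Set S)
  V : ℕ → Set S

namespace NbhdModel

/-- The truth set ⟦φ⟧_M of a formula in a neighborhood model. -/
def truthSet (M : NbhdModel) : Formula → Set M.S
  | .atom p => M.V p
  | .neg φ => (M.truthSet φ)ᶜ
  | .and φ ψ => M.truthSet φ ∩ M.truthSet ψ
  | .nabla φ => {s | M.truthSet φ ∉ M.N s ∧ (M.truthSet φ)ᶜ ∉ M.N s}
  | .bullet φ => {s | s ∈ M.truthSet φ ∧ M.truthSet φ ∉ M.N s}

/-- M,s ⊨ φ. -/
def Sat (M : NbhdModel) (s : M.S) (φ : Formula) : Prop := s ∈ M.truthSet φ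

/-- Property (n): N(s) contains the unit. -/
def PropN (M : NbhdModel) : Prop := ∀ s : M.S, (Set.univ : Set M.S) ∈ M.N s

/-- Property (r): N(s) contains its core. -/
def PropR (M : NbhdModel) : Prop := ∀ s : M.S, ⋂₀ (M.N s) ∈ M.N s

/-- Property (i): N(s) is closed under binary intersections. -/
def PropI (M : NbhdModel) : Prop :=
  ∀ (s : M.S) (X Y : Set M.S), X ∈ M.N s → Y ∈ M.N s → X ∩ Y ∈ M.N s

/-- Property (s): N(s) is supplemented (closed under supersets). -/
def PropS (M : NbhdModel) : Prop :=
  ∀ (s : M.S) (X Y : Set M.S), X ∈ M.N s → X ⊆ Y → Y ∈ M.N s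

/-- Property (c): N(s) is closed under complements. -/
def PropC (M : NbhdModel) : Prop :=
  ∀ (s : M.S) (X : Set M.S), X ∈ M.N s → Xᶜ ∈ M.N s

/-- Property (d). -/
def PropD (M : NbhdModel) : Prop :=
  ∀ (s : M.S) (X : Set M.S), X ∈ M.N s → Xᶜ ∉ M.N s

/-- Property (t). -/
def PropT (M : NbhdModel) : Prop :=
  ∀ (s : M.S) (X : Set M.S), X ∈ M.N s → s ∈ X

/-- Property (b). -/
def PropB (M : NbhdModel) : Prop :=
  ∀ (s : M.S) (X : Set M.S), s ∈ X → {u : M.S | Xᶜ ∉ M.N u} ∈ M.N s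

/-- Property (4). -/
def Prop4 (M : NbhdModel) : Prop :=
  ∀ (s : M.S) (X : Set M.S), X ∈ M.N s → {u : M.S | X ∈ M.N u} ∈ M.N s

/-- Property (5). -/
def Prop5 (M : NbhdModel) : Prop :=
  ∀ (s : M.S) (X : Set M.S), X ∉ M.N s → {u : M.S | X ∉ M.N u} ∈ M.N s

end NbhdModel

/-- φ is an instance of a propositional tautology (treating ∇ψ and •ψ subformulas
as atoms): every Boolean valuation that respects ¬ and ∧ makes φ true. -/
def IsTautology (φ : Formula) : Prop :=
  ∀ v : Formula → Bool,
    (∀ ψ : Formula, v ψ.neg = !v ψ) →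
    (∀ ψ χ : Formula, v (ψ.and χ) = (v ψ && v χ)) →
    v φ = true

/-- Theorems of the system E^{∇•} extended with the extra axioms in `Ax`:
all tautology instances, E1, E2, E3, the members of `Ax`, closed under
modus ponens, RE∇ and RE•. -/
inductive Prf (Ax : Set Formula) : Formula → Prop
  | taut {φ : Formula} : IsTautology φ → Prf Ax φ
  | e1 (φ : Formula) : Prf Ax ((Formula.nabla φ).biimp (Formula.nabla φ.neg))
  | e2 (φ : Formula) : Prf Ax ((Formula.bullet φ).imp φ)
  | e3 (φ : Formula) :
      Prf Ax ((Formula.nabla φ).imp ((Formula.bullet φ).or (Formula.bullet φ.neg)))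
  | ax {φ : Formula} : φ ∈ Ax → Prf Ax φ
  | mp {φ ψ : Formula} : Prf Ax (φ.imp ψ) → Prf Ax φ → Prf Ax ψ
  | reN {φ ψ : Formula} :
      Prf Ax (φ.biimp ψ) → Prf Ax ((Formula.nabla φ).biimp (Formula.nabla ψ))
  | reB {φ ψ : Formula} :
      Prf Ax (φ.biimp ψ) → Prf Ax ((Formula.bullet φ).biimp (Formula.bullet ψ))

/-- Γ ⊢_Λ φ: derivable from theorems of the system together with members of Γ
by modus ponens. -/
inductive Deriv (Ax : Set Formula) (Γ : Set Formula) : Formula → Prop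
  | thm {φ : Formula} : Prf Ax φ → Deriv Ax Γ φ
  | prem {φ : Formula} : φ ∈ Γ → Deriv Ax Γ φ
  | mp {φ ψ : Formula} : Deriv Ax Γ (φ.imp ψ) → Deriv Ax Γ φ → Deriv Ax Γ ψ

/-- No extra axioms: the system E^{∇•}. -/
def EAx : Set Formula := ∅

/-- Extra axiom E4: •φ → ∇φ (all instances); E^{∇•} plus these is E_c^{∇•}. -/
def EcAx : Set Formula := {α | ∃ φ : Formula, α = (Formula.bullet φ).imp (Formula.nabla φ)}

/-- Extra axiom ∘⊤; E^{∇•} plus this is EN^{∇•}. -/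
def ENAx : Set Formula := {Formula.top.bullet.neg}

/-- Extra axioms M1–M4 (all instances); E^{∇•} plus these is M^{∇•}. -/
def MAx : Set Formula :=
  {α | ∃ φ ψ χ : Formula,
      α = ((Formula.nabla (φ.or ψ)).and (Formula.nabla (φ.neg.or χ))).imp (Formula.nabla φ)} ∪
  {α | ∃ φ ψ χ : Formula,
      α = ((Formula.bullet (φ.or ψ)).and (Formula.bullet (φ.neg.or χ))).imp (Formula.nabla φ)} ∪
  {α | ∃ φ ψ χ : Formula,
      α = ((Formula.bullet (φ.or ψ)).and (Formula.nabla (φ.neg.or χ))).imp (Formula.nabla φ)} ∪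
  {α | ∃ φ ψ : Formula,
      α = (φ.circ.and φ).imp ((Formula.delta (φ.or ψ)).and (Formula.circ (φ.or ψ)))}

/-- Extra axioms of R^{∇•}: those of M^{∇•} plus R1 and R2 (all instances). -/
def RAx : Set Formula :=
  MAx ∪
  {α | ∃ φ ψ : Formula,
      α = ((Formula.delta φ).and (Formula.delta ψ)).imp (Formula.delta (φ.and ψ))} ∪
  {α | ∃ φ ψ : Formula,
      α = ((Formula.circ φ).and (Formula.circ ψ)).imp (Formula.circ (φ.and ψ))}

/-- Extra axioms of K^{∇•}: those of R^{∇•} plus ∘⊤. -/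
def KAx : Set Formula := RAx ∪ {Formula.top.bullet.neg}

namespace Deriv

variable {Ax Γ Δ : Set Formula} {φ ψ χ : Formula}

theorem mono (h : Deriv Ax Γ φ) (hs : Γ ⊆ Δ) : Deriv Ax Δ φ := by
  induction h with
  | thm h => exact thm h
  | prem h => exact prem (hs h)
  | mp _ _ ih₁ ih₂ => exact mp ih₁ ih₂

theorem taut (h : IsTautology φ) : Deriv Ax Γ φ := thm (.taut h)

theorem prf_of_empty (h : Deriv Ax ∅ φ) : Prf Ax φ := by
  induction h with
  | thm h => exact h
  | prem h => exact absurd h (Set.notMem_empty _)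
  | mp _ _ ih₁ ih₂ => exact .mp ih₁ ih₂

theorem imp_of_right (h : Deriv Ax Γ ψ) : Deriv Ax Γ (φ.imp ψ) := by
  refine mp (taut ?_) h
  intro v hn ha
  simp only [Formula.imp, Formula.or, hn, ha]
  cases v φ <;> cases v ψ <;> rfl

theorem imp_mp (h₁ : Deriv Ax Γ (φ.imp (ψ.imp χ))) (h₂ : Deriv Ax Γ (φ.imp ψ)) :
    Deriv Ax Γ (φ.imp χ) := by
  refine mp (mp (taut ?_) h₁) h₂
  intro v hn ha
  simp only [Formula.imp, Formula.or, hn, ha]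
  cases v φ <;> cases v ψ <;> cases v χ <;> rfl

theorem explosion (h₁ : Deriv Ax Γ φ) (h₂ : Deriv Ax Γ φ.neg) : Deriv Ax Γ ψ := by
  refine mp (mp (taut ?_) h₁) h₂
  intro v hn ha
  simp only [Formula.imp, Formula.or, hn, ha]
  cases v φ <;> cases v ψ <;> rfl

theorem by_cases_imp (h₁ : Deriv Ax Γ (φ.imp ψ)) (h₂ : Deriv Ax Γ (φ.neg.imp ψ)) :
    Deriv Ax Γ ψ := by
  refine mp (mp (taut ?_) h₁) h₂
  intro v hn ha
  simp only [Formula.imp, Formula.or, hn, ha]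
  cases v φ <;> cases v ψ <;> rfl

/-- The deduction theorem. -/
theorem deduction (h : Deriv Ax (insert φ Γ) ψ) : Deriv Ax Γ (φ.imp ψ) := by
  induction h with
  | thm h => exact imp_of_right (thm h)
  | prem h =>
    rcases h with rfl | h
    · refine taut fun v hn ha => ?_
      simp [Formula.imp, Formula.or, hn, ha]
    · exact imp_of_right (prem h)
  | mp _ _ ih₁ ih₂ => exact imp_mp ih₁ ih₂

theorem exists_of_sUnion {c : Set (Set Formula)} (hc : IsChain (· ⊆ ·) c) (hne : c.Nonempty)
    (h : Deriv Ax (⋃₀ c) φ) : ∃ t ∈ c, Deriv Ax t φ := by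
  induction h with
  | thm h => exact ⟨hne.some, hne.some_mem, thm h⟩
  | prem h =>
    obtain ⟨t, ht, hφ⟩ := h
    exact ⟨t, ht, prem hφ⟩
  | mp _ _ ih₁ ih₂ =>
    obtain ⟨t, ht, h₁⟩ := ih₁
    obtain ⟨u, hu, h₂⟩ := ih₂
    rcases hc.total ht hu with hs | hs
    · exact ⟨u, hu, mp (h₁.mono hs) h₂⟩
    · exact ⟨t, ht, mp h₁ (h₂.mono hs)⟩

end Deriv

/-- A maximal consistent set: a deductively closed set containing exactly one of each formula
and its negation. -/
structure IsMaximalTheory (Ax t : Set Formula) : Prop where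
  closed : ∀ φ, Deriv Ax t φ → φ ∈ t
  mem_neg : ∀ φ, φ.neg ∈ t ↔ φ ∉ t

/-- Lindenbaum's lemma. -/
theorem exists_isMaximalTheory {Ax Γ : Set Formula} {φ : Formula} (h : ¬ Deriv Ax Γ φ) :
    ∃ t, Γ ⊆ t ∧ IsMaximalTheory Ax t ∧ φ ∉ t := by
  obtain ⟨m, hΓ, hm⟩ := zorn_subset_nonempty {t : Set Formula | ¬ Deriv Ax t φ}
    (fun c hcS hc hne => ⟨⋃₀ c, fun hd => by
      obtain ⟨t, ht, htφ⟩ := hd.exists_of_sUnion hc hne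
      exact hcS ht htφ, fun _ => Set.subset_sUnion_of_mem⟩) Γ h
  have hφ : ¬ Deriv Ax m φ := hm.prop
  have imp_of_notMem : ∀ ψ, ψ ∉ m → Deriv Ax m (ψ.imp φ) := fun ψ hψ => by
    refine Deriv.deduction (by_contra fun hd => hψ ?_)
    exact hm.le_of_ge hd (Set.subset_insert ψ m) (Set.mem_insert ψ m)
  refine ⟨m, hΓ, ⟨fun ψ hd => ?_, fun ψ => ⟨fun hn hψ => ?_, fun hψ => ?_⟩⟩,
    fun hmem => hφ (.prem hmem)⟩
  · exact by_contra fun hψ => hφ (.mp (imp_of_notMem ψ hψ) hd)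
  · exact hφ (Deriv.explosion (.prem hψ) (.prem hn))
  · exact by_contra fun hn => hφ (Deriv.by_cases_imp (imp_of_notMem ψ hψ) (imp_of_notMem _ hn))

theorem prf_of_forall_mem {Ax : Set Formula} {φ : Formula}
    (h : ∀ t, IsMaximalTheory Ax t → φ ∈ t) : Prf Ax φ := by
  refine Deriv.prf_of_empty (by_contra fun hd => ?_)
  obtain ⟨t, -, ht, hφ⟩ := exists_isMaximalTheory hd
  exact hφ (h t ht)

namespace IsMaximalTheory

variable {Ax t : Set Formula}

theorem mem_of_prf (ht : IsMaximalTheory Ax t) {φ : Formula} (h : Prf Ax φ) : φ ∈ t :=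
  ht.closed _ (.thm h)

theorem mem_of_mp (ht : IsMaximalTheory Ax t) {φ ψ : Formula} (h : φ.imp ψ ∈ t) (hφ : φ ∈ t) :
    ψ ∈ t :=
  ht.closed _ (.mp (.prem h) (.prem hφ))

theorem mem_and (ht : IsMaximalTheory Ax t) (φ ψ : Formula) :
    φ.and ψ ∈ t ↔ φ ∈ t ∧ ψ ∈ t := by
  refine ⟨fun h => ⟨ht.mem_of_mp (ht.mem_of_prf (.taut ?_)) h,
    ht.mem_of_mp (ht.mem_of_prf (.taut ?_)) h⟩,
    fun h => ht.mem_of_mp (ht.mem_of_mp (ht.mem_of_prf (.taut ?_)) h.1) h.2⟩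
  all_goals
    intro v hn ha
    simp only [Formula.imp, Formula.or, hn, ha]
    cases v φ <;> cases v ψ <;> rfl

theorem mem_or (ht : IsMaximalTheory Ax t) (φ ψ : Formula) :
    φ.or ψ ∈ t ↔ φ ∈ t ∨ ψ ∈ t := by
  simp only [Formula.or, ht.mem_neg, ht.mem_and]
  tauto

theorem mem_imp (ht : IsMaximalTheory Ax t) (φ ψ : Formula) :
    φ.imp ψ ∈ t ↔ (φ ∈ t → ψ ∈ t) := by
  simp only [Formula.imp, ht.mem_or, ht.mem_neg]
  tauto

theorem mem_biimp (ht : IsMaximalTheory Ax t) (φ ψ : Formula) :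
    φ.biimp ψ ∈ t ↔ (φ ∈ t ↔ ψ ∈ t) := by
  simp only [Formula.biimp, ht.mem_and, ht.mem_imp]
  tauto

theorem mem_nabla_neg (ht : IsMaximalTheory Ax t) (φ : Formula) : φ.neg.nabla ∈ t ↔ φ.nabla ∈ t :=
  ((ht.mem_biimp _ _).1 (ht.mem_of_prf (.e1 φ))).symm

end IsMaximalTheory

theorem IsMaximalTheory.mem_bullet {t : Set Formula} (ht : IsMaximalTheory EcAx t) (φ : Formula) :
    φ.bullet ∈ t ↔ φ ∈ t ∧ φ.nabla ∈ t := by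
  have h₂ (ψ : Formula) := (ht.mem_imp _ _).1 (ht.mem_of_prf (.e2 ψ))
  have h₃ := (ht.mem_imp _ _).1 (ht.mem_of_prf (.e3 φ))
  have h₄ := (ht.mem_imp _ _).1 (ht.mem_of_prf (.ax ⟨φ, rfl⟩))
  refine ⟨fun h => ⟨h₂ φ h, h₄ h⟩, fun ⟨hφ, hN⟩ => ?_⟩
  exact ((ht.mem_or _ _).1 (h₃ hN)).resolve_right fun h => (ht.mem_neg φ).1 (h₂ _ h) hφ

/-- The maximal consistent sets containing a formula. -/
def proofSet (Ax : Set Formula) (φ : Formula) : Set {t // IsMaximalTheory Ax t} := {t | φ ∈ t.1}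

theorem proofSet_neg (Ax : Set Formula) (φ : Formula) :
    proofSet Ax φ.neg = (proofSet Ax φ)ᶜ :=
  Set.ext fun t => t.2.mem_neg φ

theorem mem_nabla_congr {Ax : Set Formula} {φ ψ : Formula} (h : proofSet Ax φ = proofSet Ax ψ)
    {t : Set Formula} (ht : IsMaximalTheory Ax t) : φ.nabla ∈ t ↔ ψ.nabla ∈ t :=
  (ht.mem_biimp _ _).1 (ht.mem_of_prf (.reN (prf_of_forall_mem fun u hu =>
    (hu.mem_biimp _ _).2 (Set.ext_iff.1 h ⟨u, hu⟩))))

/-- The canonical model, whose neighborhoods at `t` are the proof sets of the `φ` with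
`∇φ ∉ t`. -/
def canonicalModel (Ax t : Set Formula) (ht : IsMaximalTheory Ax t) : NbhdModel where
  S := {t // IsMaximalTheory Ax t}
  ne := ⟨⟨t, ht⟩⟩
  N s := {X | ∃ φ, X = proofSet Ax φ ∧ φ.nabla ∉ s.1}
  V p := proofSet Ax (.atom p)

section Canonical

variable {Ax t : Set Formula} (ht : IsMaximalTheory Ax t)

theorem canonicalModel_propC : (canonicalModel Ax t ht).PropC := by
  rintro s X ⟨φ, rfl, hφ⟩
  exact ⟨φ.neg, (proofSet_neg Ax φ).symm, fun h => hφ ((s.2.mem_nabla_neg φ).1 h)⟩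

theorem proofSet_mem_canonicalModel_N (s : {t // IsMaximalTheory Ax t}) (φ : Formula) :
    proofSet Ax φ ∈ (canonicalModel Ax t ht).N s ↔ φ.nabla ∉ s.1 :=
  ⟨fun ⟨_, h, hψ⟩ hφ => hψ ((mem_nabla_congr h s.2).1 hφ), fun h => ⟨φ, rfl, h⟩⟩

end Canonical

/-- The truth lemma. -/
theorem truthSet_canonicalModel {t : Set Formula} (ht : IsMaximalTheory EcAx t) (φ : Formula) :
    (canonicalModel EcAx t ht).truthSet φ = proofSet EcAx φ := by
  induction φ with
  | atom p => rfl
  | neg φ ih => exact (congrArg _ ih).trans (proofSet_neg EcAx φ).symm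
  | and φ ψ ih₁ ih₂ =>
    rw [NbhdModel.truthSet, ih₁, ih₂]
    exact Set.ext fun s => (s.2.mem_and φ ψ).symm
  | nabla φ ih =>
    rw [NbhdModel.truthSet, ih]
    refine Set.ext fun s => ?_
    have h₁ := proofSet_mem_canonicalModel_N ht s φ
    have h₂ := proofSet_mem_canonicalModel_N ht s φ.neg
    rw [s.2.mem_nabla_neg, proofSet_neg] at h₂
    exact (and_congr (not_congr h₁) (not_congr h₂)).trans
      ((and_self_iff).trans not_not)
  | bullet φ ih =>
    rw [NbhdModel.truthSet, ih]
    refine Set.ext fun s => ?_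
    have h₁ := proofSet_mem_canonicalModel_N ht s φ
    exact (and_congr Iff.rfl ((not_congr h₁).trans not_not)).trans (s.2.mem_bullet φ).symm

namespace NbhdModel

variable (M : NbhdModel) (s : M.S) (φ ψ : Formula)

theorem sat_neg : M.Sat s φ.neg ↔ ¬ M.Sat s φ := Iff.rfl

theorem sat_and : M.Sat s (φ.and ψ) ↔ M.Sat s φ ∧ M.Sat s ψ := Iff.rfl

theorem sat_or : M.Sat s (φ.or ψ) ↔ M.Sat s φ ∨ M.Sat s ψ := by
  simp only [Formula.or, sat_neg, sat_and]
  tauto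

theorem sat_imp : M.Sat s (φ.imp ψ) ↔ (M.Sat s φ → M.Sat s ψ) := by
  simp only [Formula.imp, sat_neg, sat_or]
  tauto

theorem sat_biimp : M.Sat s (φ.biimp ψ) ↔ (M.Sat s φ ↔ M.Sat s ψ) := by
  simp only [Formula.biimp, sat_imp, sat_and]
  tauto

theorem sat_nabla : M.Sat s φ.nabla ↔ M.truthSet φ ∉ M.N s ∧ (M.truthSet φ)ᶜ ∉ M.N s := Iff.rfl

theorem sat_bullet : M.Sat s φ.bullet ↔ M.Sat s φ ∧ M.truthSet φ ∉ M.N s := Iff.rfl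

variable {M} {φ}

open Classical in
theorem sat_of_isTautology (h : IsTautology φ) : M.Sat s φ :=
  of_decide_eq_true (h (fun ψ => decide (M.Sat s ψ)) (fun ψ => by simp [sat_neg])
    fun ψ χ => by simp [sat_and])

theorem PropC.sat_of_prf (hM : M.PropC) (h : Prf EcAx φ) : M.Sat s φ := by
  induction h generalizing s with
  | taut h => exact sat_of_isTautology s h
  | e1 φ =>
    simp only [sat_biimp, sat_nabla, truthSet, compl_compl]
    exact and_comm
  | e2 φ => exact (M.sat_imp s _ _).2 And.left
  | e3 φ =>
    simp only [sat_imp, sat_or, sat_nabla, sat_bullet, sat_neg, truthSet]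
    tauto
  | ax h =>
    obtain ⟨φ, rfl⟩ := h
    refine (M.sat_imp s _ _).2 fun h => ⟨h.2, fun hc => h.2 ?_⟩
    simpa using hM s _ hc
  | mp _ _ ih₁ ih₂ => exact (M.sat_imp s _ _).1 (ih₁ s) (ih₂ s)
  | reN _ ih =>
    have h := Set.ext fun u => (M.sat_biimp u _ _).1 (ih u)
    simp only [sat_biimp, sat_nabla]
    exact iff_of_eq (congrArg (fun X => X ∉ M.N s ∧ Xᶜ ∉ M.N s) h)
  | reB _ ih =>
    have h := Set.ext fun u => (M.sat_biimp u _ _).1 (ih u)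
    simp only [sat_biimp, sat_bullet]
    exact iff_of_eq (congrArg (fun X => s ∈ X ∧ X ∉ M.N s) h)

theorem PropC.sat_of_deriv (hM : M.PropC) {Γ : Set Formula} (hΓ : ∀ γ ∈ Γ, M.Sat s γ)
    (h : Deriv EcAx Γ φ) : M.Sat s φ := by
  induction h with
  | thm h => exact hM.sat_of_prf s h
  | prem h => exact hΓ _ h
  | mp _ _ ih₁ ih₂ => exact (M.sat_imp s _ _).1 ih₁ ih₂

end NbhdModel

/-- E_c^{∇•} is sound and strongly complete with respect to the
class of (c)-frames. -/
theorem Ec_sound_and_strongly_complete (Γ : Set Formula) (φ : Formula) :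
    Deriv EcAx Γ φ ↔
      ∀ (M : NbhdModel), M.PropC →
        ∀ s : M.S, (∀ γ ∈ Γ, M.Sat s γ) → M.Sat s φ := by
  refine ⟨fun h M hM s hΓ => hM.sat_of_deriv s hΓ h, fun h => by_contra fun hd => ?_⟩
  obtain ⟨t, hΓ, ht, hφ⟩ := exists_isMaximalTheory hd
  have sat_iff (ψ : Formula) : (canonicalModel EcAx t ht).Sat ⟨t, ht⟩ ψ ↔ ψ ∈ t :=
    Set.ext_iff.1 (truthSet_canonicalModel ht ψ) ⟨t, ht⟩
  exact hφ ((sat_iff φ).1 (h _ (canonicalModel_propC ht) ⟨t, ht⟩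
    fun γ hγ => (sat_iff γ).2 (hΓ hγ)))
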